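/- Let R be a commutative noetherian local ring, let M be a nonzero totally reflexive R-module and N a nonzero finitely generated R-module. Fix a finite free presentation F₁ → F₀ → M → 0 and let T be its transpose (the cokernel of the induced map Hom_R(F₀,R) → Hom_R(F₁,R)). If n ≥ 0 is an integer such that Ext^j_R(T,N) = 0 for all 1 ≤ j ≤ n+1, then depth_R(M ⊗_R N) ≥ min{n+1, depth_R(N)}. -/

import Mathlib

open CategoryTheory

universe u

/-- The `i`-th Ext module `Ext_R^i(M, N)` of `R`-modules `M` and `N`. -/
noncomputable def extModule (R : Type u) [CommRing R] (M N : Type u)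
    [AddCommGroup M] [Module R M] [AddCommGroup N] [Module R N] (i : ℕ) : ModuleCat.{u} R :=
  ((Ext R (ModuleCat.{u} R) i).obj (Opposite.op (ModuleCat.of R M))).obj (ModuleCat.of R N)

/-- The `i`-th Tor module `Tor^R_i(M, N)` of `R`-modules `M` and `N`. -/
noncomputable def torModule (R : Type u) [CommRing R] (M N : Type u)
    [AddCommGroup M] [Module R M] [AddCommGroup N] [Module R N] (i : ℕ) : ModuleCat.{u} R :=
  ((Tor (ModuleCat.{u} R) i).obj (ModuleCat.of R M)).obj (ModuleCat.of R N)

/-- The depth of a module `M` over a local ring `R`: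
`inf { i | Ext^i_R(k, M) ≠ 0 }` where `k` is the residue field, an element of `ℕ∞`
(the zero module has depth `⊤`, since the infimum of the empty set in `ℕ∞` is `⊤`). -/
noncomputable def moduleDepth (R : Type u) [CommRing R] [IsLocalRing R] (M : Type u)
    [AddCommGroup M] [Module R M] : ℕ∞ :=
  sInf {i : ℕ∞ | ∃ n : ℕ, i = (n : ℕ∞) ∧
    Nontrivial (extModule R (IsLocalRing.ResidueField R) M n)}

/-- A module `M` is totally reflexive if the canonical evaluation map `M → M**` is bijective
and `Ext^i_R(M, R) = 0 = Ext^i_R(M*, R)` for all `i > 0`. -/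
def IsTotallyReflexive (R : Type u) [CommRing R] (M : Type u)
    [AddCommGroup M] [Module R M] : Prop :=
  Function.Bijective (Module.Dual.eval R M) ∧
    (∀ i : ℕ, 0 < i → Subsingleton (extModule R M R i)) ∧
    (∀ i : ℕ, 0 < i → Subsingleton (extModule R (Module.Dual R M) R i))

/-- A module `P` has finite projective dimension iff for some `n`, `Ext^i_R(P, -)` vanishes
for all `i > n`. -/
def HasFiniteProjectiveDimension (R : Type u) [CommRing R] (P : Type u)
    [AddCommGroup P] [Module R P] : Prop :=
  ∃ n : ℕ, ∀ (N : Type u) [AddCommGroup N] [Module R N] (i : ℕ), n < i →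
    Subsingleton (extModule R P N i)

/-- A module `Q` has finite injective dimension iff for some `n`, `Ext^i_R(-, Q)` vanishes
for all `i > n`. -/
def HasFiniteInjectiveDimension (R : Type u) [CommRing R] (Q : Type u)
    [AddCommGroup Q] [Module R Q] : Prop :=
  ∃ n : ℕ, ∀ (N : Type u) [AddCommGroup N] [Module R N] (i : ℕ), n < i →
    Subsingleton (extModule R N Q i)

open Abelian in
/-- The vanishing of `extModule` is the vanishing of `CategoryTheory.Abelian.Ext`. -/
lemma subsingleton_extModule_iff (R : Type u) [CommRing R] (M N : Type u)
    [AddCommGroup M] [Module R M] [AddCommGroup N] [Module R N] (i : ℕ) :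
    Subsingleton (extModule R M N i) ↔
      Subsingleton (Ext (ModuleCat.of R M) (ModuleCat.of R N) i) := by
  let P := ProjectiveResolution.of (ModuleCat.of R M)
  have hP : Subsingleton (extModule R M N i) ↔
      (P.complex.linearYonedaObj R (ModuleCat.of R N)).ExactAt i := by
    rw [HomologicalComplex.exactAt_iff_isZero_homology, ← ModuleCat.isZero_iff_subsingleton]
    exact (P.isoExt (R := R) i (ModuleCat.of R N)).isZero_iff
  rw [hP]
  cases i with
  | zero =>
    rw [HomologicalComplex.exactAt_iff' _ 0 0 1 (by simp) (by simp),
      ShortComplex.moduleCat_exact_iff, Ext.homEquiv₀.subsingleton_congr]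
    let π : P.complex.X 0 ⟶ ModuleCat.of R M := P.π.f 0
    have : Epi π := inferInstanceAs (Epi (P.π.f 0))
    have hπ : P.complex.d 1 0 ≫ π = 0 := P.complex_d_comp_π_f_zero
    have hexact : (ShortComplex.mk _ _ hπ).Exact := P.exact₀
    constructor
    · intro h
      refine subsingleton_of_forall_eq 0 fun φ => ?_
      obtain ⟨x, hx⟩ := h (π ≫ φ) (show P.complex.d 1 0 ≫ π ≫ φ = 0 by simp [reassoc_of% hπ])
      replace hx : P.complex.d 0 0 ≫ (show P.complex.X 0 ⟶ ModuleCat.of R N from x) = π ≫ φ := hx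
      rw [← cancel_epi π, ← hx, P.complex.shape 0 0 (by simp), Limits.zero_comp, Limits.comp_zero]
    · intro h (x : P.complex.X 0 ⟶ ModuleCat.of R N) (hx : P.complex.d 1 0 ≫ x = 0)
      refine ⟨0, ?_⟩
      have : Epi (ShortComplex.mk _ _ hπ).g := ‹Epi π›
      rw [map_zero]
      change 0 = x
      rw [← hexact.g_desc x hx, Subsingleton.elim (hexact.desc x hx) 0, Limits.comp_zero]
  | succ p =>
    rw [HomologicalComplex.exactAt_iff' _ p (p + 1) (p + 2) (by simp) (by simp),
      ShortComplex.moduleCat_exact_iff]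
    constructor
    · intro h
      refine subsingleton_of_forall_eq 0 fun α => ?_
      obtain ⟨φ, hφ, rfl⟩ := P.extMk_surjective α (p + 2) rfl
      exact (P.extMk_eq_zero_iff φ (p + 2) rfl hφ p rfl).2 (h φ hφ)
    · intro h φ hφ
      exact (P.extMk_eq_zero_iff φ (p + 2) rfl hφ p rfl).1 (Subsingleton.elim _ _)

lemma le_moduleDepth_iff (R : Type u) [CommRing R] [IsLocalRing R] (M : Type u)
    [AddCommGroup M] [Module R M] (m : ℕ∞) :
    m ≤ moduleDepth R M ↔ ∀ i : ℕ, (i : ℕ∞) < m →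
      Subsingleton (Abelian.Ext (ModuleCat.of R (IsLocalRing.ResidueField R))
        (ModuleCat.of R M) i) := by
  simp only [moduleDepth, le_sInf_iff, Set.mem_ofPred_eq, ← subsingleton_extModule_iff]
  simp only [← not_nontrivial_iff_subsingleton]
  constructor
  · intro h i hi hn
    exact (h i ⟨i, rfl, hn⟩).not_gt hi
  · rintro h _ ⟨i, rfl, hn⟩
    exact not_lt.1 fun hi => h i hi hn

namespace CategoryTheory.Abelian.Ext

variable {C : Type*} [Category* C] [Abelian C] [HasExt C]

/-- In a short exact sequence, if `Ext K` of the middle term vanishes in degrees `≤ m` and that of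
the right term in degrees `< m`, then `Ext K` of the left term vanishes in degrees `≤ m`. -/
lemma subsingleton_X₁_of_shortExact {S : ShortComplex C} (hS : S.ShortExact) (K : C) (m : ℕ)
    (h₂ : ∀ i < m + 1, Subsingleton (Ext K S.X₂ i)) (h₃ : ∀ i < m, Subsingleton (Ext K S.X₃ i))
    (i : ℕ) (hi : i < m + 1) : Subsingleton (Ext K S.X₁ i) := by
  have := h₂ i hi
  refine subsingleton_of_forall_eq 0 fun x => ?_
  cases i with
  | zero =>
    have := hS.mono_f
    exact postcomp_mk₀_injective_of_mono K S.f (Subsingleton.elim _ _)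
  | succ i =>
    obtain ⟨y, rfl⟩ := covariant_sequence_exact₁ K hS x (Subsingleton.elim _ _) rfl
    have := h₃ i (by lia)
    rw [Subsingleton.elim y 0, zero_comp]

/-- In a short exact sequence with projective middle term, positive degree `Ext` of the left term
is `Ext` of the right term in the next degree. -/
lemma subsingleton_X₁_of_projective_X₂ {S : ShortComplex C} (hS : S.ShortExact) [Projective S.X₂]
    (Y : C) (i : ℕ) [Subsingleton (Ext S.X₃ Y (i + 2))] : Subsingleton (Ext S.X₁ Y (i + 1)) := by
  refine subsingleton_of_forall_eq 0 fun x => ?_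
  obtain ⟨y, rfl⟩ := contravariant_sequence_exact₁ hS Y x (n₁ := i + 2) (by lia)
    (Subsingleton.elim _ _)
  rw [eq_zero_of_projective y, comp_zero]

/-- In a short exact sequence whose right term has no `Ext¹`, morphisms extend from the left term
to the middle term. -/
lemma exists_comp_eq_of_shortExact {S : ShortComplex C} (hS : S.ShortExact) {Y : C}
    [Subsingleton (Ext S.X₃ Y 1)] (φ : S.X₁ ⟶ Y) : ∃ ψ : S.X₂ ⟶ Y, S.f ≫ ψ = φ := by
  obtain ⟨y, hy⟩ := contravariant_sequence_exact₁ hS Y (mk₀ φ) (n₁ := 1) (by lia)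
    (Subsingleton.elim _ _)
  obtain ⟨ψ, rfl⟩ := (mk₀_bijective _ _).2 y
  exact ⟨ψ, (mk₀_bijective _ _).1 (by rw [← hy, mk₀_comp_mk₀])⟩

lemma subsingleton_of_iso (K : C) {X Y : C} (φ : X ≅ Y) (i : ℕ) [Subsingleton (Ext K X i)] :
    Subsingleton (Ext K Y i) := by
  refine subsingleton_of_forall_eq 0 fun x => ?_
  rw [← x.comp_mk₀_id, ← φ.inv_hom_id, ← mk₀_comp_mk₀, ← comp_assoc_of_second_deg_zero,
    Subsingleton.elim (x.comp (mk₀ φ.inv) (add_zero i)) 0, zero_comp]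

end CategoryTheory.Abelian.Ext

section

variable {R : Type u} [CommRing R]

lemma subsingleton_ext_hom_of_free (K : ModuleCat.{u} R) (P N : Type u)
    [AddCommGroup P] [Module R P] [Module.Free R P] [Module.Finite R P]
    [AddCommGroup N] [Module R N] (i : ℕ) [Subsingleton (Abelian.Ext K (ModuleCat.of R N) i)] :
    Subsingleton (Abelian.Ext K (ModuleCat.of R (P →ₗ[R] N)) i) := by
  let b := Module.Free.chooseBasis R P
  let ev (j : Module.Free.ChooseBasisIndex R P) :
      ModuleCat.of R (P →ₗ[R] N) ⟶ ModuleCat.of R N :=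
    ModuleCat.ofHom (LinearMap.applyₗ (b j))
  let co (j : Module.Free.ChooseBasisIndex R P) :
      ModuleCat.of R N ⟶ ModuleCat.of R (P →ₗ[R] N) :=
    ModuleCat.ofHom (LinearMap.smulRightₗ (b.coord j))
  have hid : 𝟙 (ModuleCat.of R (P →ₗ[R] N)) = ∑ j, ev j ≫ co j := by
    ext φ : 2
    refine b.ext fun l => ?_
    simp [ev, co, ModuleCat.hom_sum, Finsupp.single_apply]
  refine subsingleton_of_forall_eq 0 fun x => ?_
  rw [← x.comp_mk₀_id, hid, Abelian.Ext.mk₀_sum, Abelian.Ext.comp_sum]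
  refine Finset.sum_eq_zero fun j _ => ?_
  rw [← Abelian.Ext.mk₀_comp_mk₀, ← Abelian.Ext.comp_assoc_of_second_deg_zero,
    Subsingleton.elim (x.comp (Abelian.Ext.mk₀ (ev j)) (add_zero i)) 0, Abelian.Ext.zero_comp]

/-- The short exact sequence `0 → P₁ / im e → P₀ → P₀ / im d → 0` attached to an exact sequence
`P₂ → P₁ → P₀`. -/
lemma shortExact_liftQ_mkQ {P₀ P₁ P₂ : Type u} [AddCommGroup P₀] [Module R P₀]
    [AddCommGroup P₁] [Module R P₁] [AddCommGroup P₂] [Module R P₂]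
    (d : P₁ →ₗ[R] P₀) (e : P₂ →ₗ[R] P₁) (h : Function.Exact e d) :
    (ShortComplex.mk
      (ModuleCat.ofHom ((LinearMap.range e).liftQ d (LinearMap.exact_iff.1 h).ge))
      (ModuleCat.ofHom (LinearMap.range d).mkQ)
      (by ext x; simp)).ShortExact := by
  refine ModuleCat.shortComplex_shortExact _ ?_ ?_ (Submodule.mkQ_surjective _)
  · rw [LinearMap.exact_iff]
    exact (Submodule.ker_mkQ _).trans (Submodule.range_liftQ _ _ _).symm
  · exact LinearMap.ker_eq_bot.1 (Submodule.ker_liftQ_eq_bot _ _ _ (LinearMap.exact_iff.1 h).le)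

/-- If `Ext^j(coker d, N)` vanishes for `1 ≤ j ≤ m`, where `d` is a map of finite free modules,
then the cokernel of `Hom(d, N)` inherits the vanishing of `Ext^i(K, N)` for `i < m`. -/
lemma subsingleton_ext_coker_lcomp [IsNoetherianRing R] (K : ModuleCat.{u} R) (N : Type u)
    [AddCommGroup N] [Module R N] (m : ℕ)
    (hK : ∀ i < m, Subsingleton (Abelian.Ext K (ModuleCat.of R N) i))
    (P₀ P₁ : Type u) [AddCommGroup P₀] [Module R P₀] [Module.Free R P₀]
    [AddCommGroup P₁] [Module R P₁] [Module.Free R P₁] [Module.Finite R P₁]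
    (d : P₁ →ₗ[R] P₀)
    (hd : ∀ j, 1 ≤ j → j ≤ m → Subsingleton
      (Abelian.Ext (ModuleCat.of R (P₀ ⧸ LinearMap.range d)) (ModuleCat.of R N) j)) :
    ∀ i < m, Subsingleton
      (Abelian.Ext K (ModuleCat.of R ((P₁ →ₗ[R] N) ⧸ LinearMap.range (d.lcomp R N))) i) := by
  induction m generalizing P₀ P₁ with
  | zero => simp
  | succ m ih =>
    obtain ⟨r, e', he'⟩ := Module.Finite.exists_fin' R (LinearMap.ker d)
    let e : (Fin r → R) →ₗ[R] P₁ := (LinearMap.ker d).subtype ∘ₗ e'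
    have hed : Function.Exact e d := by
      rw [LinearMap.exact_iff, LinearMap.range_comp_of_range_eq_top _ (LinearMap.range_eq_top.2 he'),
        Submodule.range_subtype]
    have hS := shortExact_liftQ_mkQ d e hed
    have hHom : Function.Exact (d.lcomp R N) (e.lcomp R N) := by
      intro φ
      constructor
      · intro hφ
        have := hd 1 le_rfl (by lia)
        obtain ⟨ψ, hψ⟩ := Abelian.Ext.exists_comp_eq_of_shortExact hS (Y := ModuleCat.of R N)
          (ModuleCat.ofHom ((LinearMap.range e).liftQ φ (by
            rw [LinearMap.range_le_ker_iff]; exact hφ)))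
        refine ⟨ψ.hom, ?_⟩
        ext x
        exact congr($(hψ).hom (Submodule.Quotient.mk x))
      · rintro ⟨ψ, rfl⟩
        ext x
        simp [hed.apply_apply_eq_zero]
    refine Abelian.Ext.subsingleton_X₁_of_shortExact
      (shortExact_liftQ_mkQ (e.lcomp R N) (d.lcomp R N) hHom) K m (fun i hi => ?_)
      (ih (fun i hi => hK i (by lia)) P₁ (Fin r → R) e fun j hj hjm => ?_)
    · have := hK i hi
      exact subsingleton_ext_hom_of_free K _ N i
    · obtain ⟨j, rfl⟩ := Nat.exists_eq_add_of_le' hj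
      have := hd (j + 2) (by lia) (by lia)
      have : Projective (ModuleCat.of R P₀) := inferInstance
      exact Abelian.Ext.subsingleton_X₁_of_projective_X₂ hS _ j

/-- For a presentation `F₁ → F₀ → M → 0` by finite free modules, `M ⊗ N` is the cokernel of
`Hom(F₁*, N) → Hom(F₀*, N)`. -/
noncomputable def tensorEquivCokerLcompDualMap {M N F₀ F₁ : Type u} [AddCommGroup M] [Module R M]
    [AddCommGroup N] [Module R N]
    [AddCommGroup F₀] [Module R F₀] [Module.Free R F₀] [Module.Finite R F₀]
    [AddCommGroup F₁] [Module R F₁] [Module.Free R F₁] [Module.Finite R F₁]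
    (f : F₁ →ₗ[R] F₀) (g : F₀ →ₗ[R] M) (hg : Function.Surjective g) (hfg : Function.Exact f g) :
    ((Module.Dual R F₀ →ₗ[R] N) ⧸ LinearMap.range (f.dualMap.lcomp R N)) ≃ₗ[R]
      TensorProduct R M N :=
  let E (F : Type u) [AddCommGroup F] [Module R F] [Module.Free R F] [Module.Finite R F] :
      TensorProduct R F N ≃ₗ[R] (Module.Dual R F →ₗ[R] N) :=
    (TensorProduct.congr (Module.evalEquiv R F) (.refl R N)).trans
      (dualTensorHomEquiv R (Module.Dual R F) N)
  have hE : f.dualMap.lcomp R N ∘ₗ (E F₁).toLinearMap =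
      (E F₀).toLinearMap ∘ₗ f.rTensor N := by
    ext x y φ
    simp [E]
  (Submodule.Quotient.equiv _ _ (E F₀) (by
    rw [← LinearMap.range_comp, ← hE, LinearMap.range_comp,
      LinearEquiv.range, Submodule.map_top])).symm.trans (rTensor.equiv N hfg hg)

end

/-- **Lemma 3.1.** Let `R` be a noetherian local ring, `M` a nonzero totally reflexive
`R`-module and `N` a nonzero finitely generated `R`-module, with `T` the transpose of a finite
free presentation `F₁ → F₀ → M → 0`.  If `n ≥ 0` and `Ext^j_R(T, N) = 0` for `1 ≤ j ≤ n + 1`,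
then `depth(M ⊗ N) ≥ min (n + 1) (depth N)`. -/
theorem depth_tensor_ge_of_totallyReflexive
    (R : Type u) [CommRing R] [IsNoetherianRing R] [IsLocalRing R]
    (M N : Type u) [AddCommGroup M] [Module R M] [Module.Finite R M] [Nontrivial M]
    [AddCommGroup N] [Module R N] [Module.Finite R N] [Nontrivial N]
    (hM : IsTotallyReflexive R M)
    (F₀ F₁ : Type u)
    [AddCommGroup F₀] [Module R F₀] [Module.Free R F₀] [Module.Finite R F₀]
    [AddCommGroup F₁] [Module R F₁] [Module.Free R F₁] [Module.Finite R F₁]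
    (f : F₁ →ₗ[R] F₀) (g : F₀ →ₗ[R] M)
    (hg : Function.Surjective g) (hfg : LinearMap.range f = LinearMap.ker g)
    (n : ℕ)
    (hExt : ∀ j : ℕ, 1 ≤ j → j ≤ n + 1 →
      Subsingleton (extModule R
        (Module.Dual R F₁ ⧸ LinearMap.range (LinearMap.dualMap f)) N j)) :
    min ((n : ℕ∞) + 1) (moduleDepth R N) ≤ moduleDepth R (TensorProduct R M N) := by
  have hfg' : Function.Exact f g := LinearMap.exact_iff.2 hfg.symm
  rw [le_moduleDepth_iff]
  intro i hi
  obtain ⟨hi₁, hi₂⟩ := lt_min_iff.1 hi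
  have hN := (le_moduleDepth_iff R N _).1 le_rfl
  have h := subsingleton_ext_coker_lcomp (ModuleCat.of R (IsLocalRing.ResidueField R)) N (i + 1)
    (fun j hj => hN j (lt_of_le_of_lt (by exact_mod_cast Nat.le_of_lt_succ hj) hi₂)) _ _ f.dualMap
    (fun j hj hji => (subsingleton_extModule_iff R _ N j).1
      (hExt j hj (hji.trans (by exact_mod_cast hi₁)))) i (Nat.lt_succ_self i)
  let φ := (tensorEquivCokerLcompDualMap (N := N) f g hg hfg').toModuleIso
  exact Abelian.Ext.subsingleton_of_iso _ φ i
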